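/- (Inverse theorem.) Let g* ∈ L^∞([-1,1]) and G*_{k,g*} the operators defined by G*_{k,g*}(t) = ∑_{j=0}^{4k} β_j φ(kt - j + 2k) with β_j as in the construction (β_j = g*(-1) for j ≤ k-1, g*((j-2k)/k) for k ≤ j ≤ 3k, g*(1) for j ≥ 3k+1) and φ(t) = (σ(t+1)-σ(t-1))/2. Then there is a constant C independent of n and g* such that ω(g*, 1/n) + (1/n)‖g*‖_{L^∞([-1,1])} ≤ (C/n) ∑_{k=1}^n ‖G*_{k,g*} - g*‖_{L^∞([-1,1])}. -/

import Mathlib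

open Set

noncomputable def sigmoid (t : ℝ) : ℝ := 1 / (1 + Real.exp (-t))

noncomputable def phi (t : ℝ) : ℝ := (sigmoid (t + 1) - sigmoid (t - 1)) / 2

noncomputable def beta (n : ℕ) (g : ℝ → ℝ) (k : ℕ) : ℝ :=
  if k ≤ n - 1 then g (-1)
  else if k ≤ 3 * n then g (((k : ℝ) - 2 * n) / n)
  else g 1

noncomputable def Gop (n : ℕ) (g : ℝ → ℝ) (t : ℝ) : ℝ :=
  ∑ k ∈ Finset.range (4 * n + 1), beta n g k * phi ((n : ℝ) * t - (k : ℝ) + 2 * n)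

/-- Sup norm on `[-1,1]`. -/
noncomputable def supNorm (g : ℝ → ℝ) : ℝ :=
  sSup {v : ℝ | ∃ x ∈ Icc (-1 : ℝ) 1, v = |g x|}

/-- Modulus of continuity on `[-1,1]`. -/
noncomputable def modCont (g : ℝ → ℝ) (h : ℝ) : ℝ :=
  sSup {v : ℝ | ∃ s x : ℝ, 0 < s ∧ s ≤ h ∧ x ∈ Icc (-1 : ℝ) 1 ∧
    x + s ∈ Icc (-1 : ℝ) 1 ∧ v = |g x - g (x + s)|}

/-! ### The sigmoid -/

theorem sig_pos (t : ℝ) : 0 < sigmoid t := by unfold sigmoid; positivity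

theorem sig_neg (t : ℝ) : sigmoid (-t) = 1 - sigmoid t := by
  unfold sigmoid
  have h : Real.exp (-t) * Real.exp t = 1 := by rw [← Real.exp_add]; simp
  have h1 := Real.exp_pos t
  have h2 := Real.exp_pos (-t)
  rw [neg_neg]
  field_simp
  nlinarith

theorem sig_lt_one (t : ℝ) : sigmoid t < 1 := by
  have := sig_pos (-t); rw [sig_neg] at this; linarith

theorem sig_le_exp (t : ℝ) : sigmoid t ≤ Real.exp t := by
  unfold sigmoid
  have h : Real.exp t * Real.exp (-t) = 1 := by rw [← Real.exp_add]; simp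
  rw [div_le_iff₀ (by positivity)]
  nlinarith [Real.exp_pos t]

theorem sig_mono : Monotone sigmoid := by
  intro a b h
  unfold sigmoid
  gcongr

/-- derivative of the sigmoid -/
noncomputable def sigD (t : ℝ) : ℝ := sigmoid t * (1 - sigmoid t)

theorem sig_deriv (t : ℝ) : HasDerivAt sigmoid (sigD t) t := by
  have h1 : HasDerivAt (fun t : ℝ => 1 + Real.exp (-t)) (-Real.exp (-t)) t := by
    have := ((hasDerivAt_neg t).exp).const_add 1
    simpa using this
  have h2 := h1.inv (by positivity)
  have : sigmoid = (fun t : ℝ => 1 + Real.exp (-t))⁻¹ := by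
    ext x; simp [sigmoid]
  rw [this]
  refine h2.congr_deriv ?_
  unfold sigD sigmoid
  have := Real.exp_pos (-t)
  field_simp
  ring

theorem sigD_deriv (t : ℝ) : HasDerivAt sigD (sigD t * (1 - 2 * sigmoid t)) t := by
  have h := (sig_deriv t).mul ((sig_deriv t).const_sub 1)
  refine HasDerivAt.congr_deriv (f := sigD) h ?_
  unfold sigD; ring

theorem sigD_nonneg (t : ℝ) : 0 ≤ sigD t :=
  mul_nonneg (sig_pos t).le (by linarith [sig_lt_one t])

theorem sigD_le (t : ℝ) : sigD t ≤ Real.exp (-|t|) := by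
  unfold sigD
  have a := sig_pos t
  have b := sig_lt_one t
  rcases abs_cases t with ⟨h, _⟩ | ⟨h, _⟩ <;> rw [h]
  · have := sig_le_exp (-t); rw [sig_neg] at this; nlinarith
  · have := sig_le_exp t; rw [neg_neg]; nlinarith

theorem sigDD_le (t : ℝ) : |sigD t * (1 - 2 * sigmoid t)| ≤ Real.exp (-|t|) := by
  rw [abs_mul, abs_of_nonneg (sigD_nonneg t)]
  have : |1 - 2 * sigmoid t| ≤ 1 := by
    rw [abs_le]; constructor <;> linarith [sig_pos t, sig_lt_one t]
  calc _ ≤ sigD t * 1 := mul_le_mul_of_nonneg_left this (sigD_nonneg t)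
    _ ≤ _ := by rw [mul_one]; exact sigD_le t

/-! ### The primitive of `phi` -/

noncomputable def sf (x : ℝ) : ℝ := (sigmoid (x + 1) + sigmoid x) / 2
noncomputable def sfD (x : ℝ) : ℝ := (sigD (x + 1) + sigD x) / 2
noncomputable def sfDD (x : ℝ) : ℝ :=
  (sigD (x + 1) * (1 - 2 * sigmoid (x + 1)) + sigD x * (1 - 2 * sigmoid x)) / 2

theorem phi_eq (x : ℝ) : phi x = sf x - sf (x - 1) := by
  unfold phi sf; rw [sub_add_cancel]; ring

theorem sf_pos (x : ℝ) : 0 < sf x := by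
  unfold sf; linarith [sig_pos (x + 1), sig_pos x]

theorem sf_lt_one (x : ℝ) : sf x < 1 := by
  unfold sf; linarith [sig_lt_one (x + 1), sig_lt_one x]

theorem sf_mono : Monotone sf := by
  intro a b h
  unfold sf
  have := sig_mono h
  have := sig_mono (show a + 1 ≤ b + 1 by linarith)
  linarith

theorem sf_deriv (x : ℝ) : HasDerivAt sf (sfD x) x := by
  have h1 := (sig_deriv (x + 1)).comp_add_const x 1
  exact (h1.add (sig_deriv x)).div_const 2

theorem sfD_deriv (x : ℝ) : HasDerivAt sfD (sfDD x) x := by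
  have h1 := (sigD_deriv (x + 1)).comp_add_const x 1
  exact (h1.add (sigD_deriv x)).div_const 2

theorem exp_shift (x y : ℝ) (h : |x - y| ≤ 1) : Real.exp (-|x|) ≤ 3 * Real.exp (-|y|) := by
  have h1 : -|x| ≤ 1 + -|y| := by
    have := abs_sub_abs_le_abs_sub y x
    rw [abs_sub_comm] at this; linarith
  calc Real.exp (-|x|) ≤ Real.exp (1 + -|y|) := Real.exp_le_exp.2 h1
    _ = Real.exp 1 * Real.exp (-|y|) := Real.exp_add _ _
    _ ≤ _ := by
      have := Real.exp_one_lt_d9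
      gcongr; linarith

theorem sfD_nonneg (x : ℝ) : 0 ≤ sfD x := by
  unfold sfD; linarith [sigD_nonneg (x + 1), sigD_nonneg x]

theorem sfD_le (x : ℝ) : |sfD x| ≤ 3 * Real.exp (-|x|) := by
  rw [abs_of_nonneg (sfD_nonneg x)]
  have h1 := sigD_le (x + 1)
  have h2 := sigD_le x
  have h3 := exp_shift (x + 1) x (by simp)
  have := Real.exp_pos (-|x|)
  unfold sfD; linarith

theorem sfDD_le (x : ℝ) : |sfDD x| ≤ 3 * Real.exp (-|x|) := by
  have h1 := sigDD_le (x + 1)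
  have h2 := sigDD_le x
  have h3 := exp_shift (x + 1) x (by simp)
  have := Real.exp_pos (-|x|)
  unfold sfDD
  rw [abs_le] at *
  constructor <;> linarith

theorem sf_diff_le (θ m : ℝ) (h0 : 0 ≤ θ) (h1 : θ ≤ 1) :
    |sf (θ - m) - sf (-m)| ≤ 9 * Real.exp (-|m|) := by
  have key := (convex_Icc (-m) (1 - m)).norm_image_sub_le_of_norm_hasDerivWithin_le
    (f := sf) (f' := sfD) (C := 9 * Real.exp (-|m|)) (x := -m) (y := θ - m)
    (fun x _ => (sf_deriv x).hasDerivWithinAt)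
    (fun x hx => by
      rw [Real.norm_eq_abs]
      refine (sfD_le x).trans ?_
      have := exp_shift x (-m) (by rw [abs_le]; constructor <;> linarith [hx.1, hx.2])
      rw [abs_neg] at this
      linarith)
    ⟨by linarith, by linarith⟩ ⟨by linarith, by linarith⟩
  rw [Real.norm_eq_abs, Real.norm_eq_abs] at key
  refine key.trans ?_
  have : |θ - m - -m| ≤ 1 := by rw [abs_le]; constructor <;> linarith
  have h9 : 0 ≤ 9 * Real.exp (-|m|) := by positivity
  nlinarith

/-! ### Exponential sums -/

theorem summable_exp_int (c : ℝ) (hc : 0 < c) :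
    Summable (fun i : ℤ => Real.exp (-(c * |(i : ℝ)|))) := by
  have h : Summable (fun n : ℕ => Real.exp (-(c * n))) := by
    have := Real.summable_exp_nat_mul_iff.2 (show -c < 0 by linarith)
    refine this.congr fun n => ?_
    congr 1; ring
  refine Summable.of_nat_of_neg ?_ ?_
  · simpa using h
  · simpa using h

theorem exp_sum_bound : ∃ K : ℝ, 1 ≤ K ∧ ∀ (S : Finset ℕ) (x : ℝ),
    ∑ j ∈ S, Real.exp (-(|x - j| / 2)) ≤ K := by
  have hs := summable_exp_int (1 / 2) (by norm_num)
  refine ⟨1 + Real.exp (1 / 2) * ∑' i : ℤ, Real.exp (-(1 / 2 * |(i : ℝ)|)), ?_, ?_⟩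
  · have : 0 ≤ ∑' i : ℤ, Real.exp (-(1 / 2 * |(i : ℝ)|)) := tsum_nonneg fun _ => (Real.exp_pos _).le
    have := mul_nonneg (Real.exp_pos (1 / 2)).le this
    linarith
  · intro S x
    have h1 : ∀ j ∈ S, Real.exp (-(|x - j| / 2)) ≤
        Real.exp (1 / 2) * Real.exp (-(1 / 2 * |((⌊x⌋ - (j : ℤ) : ℤ) : ℝ)|)) := by
      intro j _
      rw [← Real.exp_add]
      apply Real.exp_le_exp.2
      push_cast
      have h2 : |(⌊x⌋ : ℝ) - j| ≤ |x - j| + 1 := by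
        have : |(⌊x⌋ : ℝ) - x| ≤ 1 := by
          rw [abs_le]; constructor <;> linarith [Int.floor_le x, Int.lt_floor_add_one x]
        have h3 := abs_add_le ((⌊x⌋ : ℝ) - x) (x - j)
        rw [sub_add_sub_cancel] at h3
        linarith
      linarith
    refine (Finset.sum_le_sum h1).trans ?_
    rw [← Finset.mul_sum]
    have hinj : Set.InjOn (fun j : ℕ => ⌊x⌋ - (j : ℤ)) S := by
      intro a _ b _ h; simpa using h
    have h4 := Finset.sum_image (s := S) (g := fun j : ℕ => ⌊x⌋ - (j : ℤ))
      (f := fun i : ℤ => Real.exp (-(1 / 2 * |(i : ℝ)|))) hinj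
    rw [← h4]
    have h5 := hs.sum_le_tsum (S.image (fun j : ℕ => ⌊x⌋ - (j : ℤ))) (fun _ _ => (Real.exp_pos _).le)
    have := mul_le_mul_of_nonneg_left h5 (Real.exp_pos (1 / 2)).le
    linarith
/-! ### Nonlinearity: `∑ σ(θ-m) - σ(-m)` is not identically `θ` -/

noncomputable def tc (m : ℤ) (z : ℂ) : ℂ :=
  if m = 0 then 0 else
    1 / (1 + Complex.exp (m - z)) - 1 / (1 + Complex.exp m)

theorem tc_ne (m : ℤ) (hm : m ≠ 0) (z : ℂ) (hz : |z.re| < 1 / 2) :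
    (1 - Real.exp (-(1 / 2))) * max 1 (Real.exp (m - z.re)) ≤ ‖1 + Complex.exp (m - z)‖ := by
  have hn : ‖Complex.exp (m - z)‖ = Real.exp (m - z.re) := by
    rw [Complex.norm_exp]; simp
  have hz' := abs_lt.1 hz
  have hmul : Real.exp (-(1/2)) * Real.exp (1/2) = 1 := by rw [← Real.exp_add]; simp
  have hpos := Real.exp_pos (-(1/2 : ℝ))
  rcases lt_or_gt_of_ne hm with h | h
  · have hm1 : (m : ℝ) ≤ -1 := by exact_mod_cast (by omega : m ≤ -1)
    have h1 : Real.exp (m - z.re) ≤ Real.exp (-(1 / 2)) := Real.exp_le_exp.2 (by linarith)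
    have h2 : Real.exp (-(1 / 2 : ℝ)) ≤ 1 := Real.exp_le_one_iff.2 (by norm_num)
    rw [max_eq_left (h1.trans h2)]
    have h3 := norm_sub_le_norm_add (1 : ℂ) (Complex.exp (m - z))
    rw [hn, norm_one] at h3
    linarith
  · have hm1 : (1 : ℝ) ≤ m := by exact_mod_cast (by omega : 1 ≤ m)
    have h1 : Real.exp (1 / 2) ≤ Real.exp (m - z.re) := Real.exp_le_exp.2 (by linarith)
    have h2 : 1 ≤ Real.exp (1 / 2 : ℝ) := Real.one_le_exp (by norm_num)
    rw [max_eq_right (h2.trans h1)]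
    have h3 := norm_sub_le_norm_add (Complex.exp (m - z)) (1 : ℂ)
    rw [hn, norm_one, add_comm] at h3
    nlinarith

theorem tc_den (m : ℤ) (hm : m ≠ 0) (z : ℂ) (hz : |z.re| < 1 / 2) :
    1 + Complex.exp (m - z) ≠ 0 := by
  have h := tc_ne m hm z hz
  have h2 : Real.exp (-(1 / 2 : ℝ)) < 1 := Real.exp_lt_one_iff.2 (by norm_num)
  have : 0 < (1 - Real.exp (-(1 / 2))) * max 1 (Real.exp (m - z.re)) := by
    apply mul_pos (by linarith); positivity
  exact norm_pos_iff.1 (this.trans_le h)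

theorem tc_bound : ∃ K : ℝ, ∀ (m : ℤ) (z : ℂ), |z.re| < 1 / 2 →
    ‖tc m z‖ ≤ K * Real.exp (-(1 * |(m : ℝ)|)) := by
  set c := 1 - Real.exp (-(1 / 2 : ℝ)) with hc
  have h2 : Real.exp (-(1 / 2 : ℝ)) < 1 := Real.exp_lt_one_iff.2 (by norm_num)
  have hc0 : 0 < c := by linarith
  refine ⟨3 / c * (1 + Real.exp (1 / 2)), fun m z hz => ?_⟩
  unfold tc
  split_ifs with hm
  · simp only [norm_zero]; positivity
  have hd := tc_den m hm z hz
  have hb := tc_ne m hm z hz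
  rw [← hc] at hb
  have e1 : (1 : ℂ) + Complex.exp m = ((1 + Real.exp m : ℝ) : ℂ) := by push_cast; rfl
  have hd1 : (1 : ℂ) + Complex.exp m ≠ 0 := by
    rw [e1]; exact_mod_cast (by positivity)
  have e2 : 1 / (1 + Complex.exp (m - z)) - 1 / (1 + Complex.exp m)
      = Complex.exp m * (1 - Complex.exp (-z)) /
        ((1 + Complex.exp (m - z)) * (1 + Complex.exp m)) := by
    rw [div_sub_div _ _ hd hd1]
    congr 1
    rw [sub_eq_add_neg (m : ℂ) z, Complex.exp_add]; ring
  rw [e2, norm_div, norm_mul, norm_mul, e1, Complex.norm_real, Real.norm_eq_abs,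
    abs_of_pos (by positivity : 0 < 1 + Real.exp m)]
  have n1 : ‖Complex.exp (m : ℂ)‖ = Real.exp m := by rw [Complex.norm_exp]; simp
  have hz' := abs_lt.1 hz
  have n2 : ‖1 - Complex.exp (-z)‖ ≤ 1 + Real.exp (1 / 2) := by
    refine (norm_sub_le _ _).trans ?_
    rw [norm_one, Complex.norm_exp]
    gcongr
    simp only [Complex.neg_re]; linarith
  rw [n1]
  have hD : 0 < c * max 1 (Real.exp (m - z.re)) * (1 + Real.exp m) := by positivity
  have key : Real.exp m ≤ 3 * Real.exp (-(1 * |(m : ℝ)|)) * (max 1 (Real.exp (m - z.re)) * (1 + Real.exp m)) := by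
    rcases le_total (m : ℝ) 0 with h | h
    · rw [abs_of_nonpos h, one_mul, neg_neg]
      have a1 : 1 ≤ max 1 (Real.exp (m - z.re)) := le_max_left _ _
      have a2 := Real.exp_pos (m : ℝ)
      have a3 : 1 ≤ max 1 (Real.exp (m - z.re)) * (1 + Real.exp m) := by nlinarith
      nlinarith
    · rw [abs_of_nonneg h, one_mul]
      have a1 : Real.exp (m - z.re) ≤ max 1 (Real.exp (m - z.re)) := le_max_right _ _
      have a2 := Real.exp_pos (m : ℝ)
      have a4 : Real.exp (-(m : ℝ)) * Real.exp (m - z.re) = Real.exp (-z.re) := by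
        rw [← Real.exp_add]; congr 1; ring
      have a5 : 1 ≤ 3 * Real.exp (-z.re) := by
        have : Real.exp (-1) ≤ Real.exp (-z.re) := Real.exp_le_exp.2 (by linarith)
        have h4 : Real.exp (-1) * Real.exp 1 = 1 := by rw [← Real.exp_add]; simp
        have := Real.exp_one_lt_d9
        nlinarith [Real.exp_pos (-1)]
      have a6 : 1 ≤ 3 * (Real.exp (-(m : ℝ)) * max 1 (Real.exp (m - z.re))) := by
        have := mul_le_mul_of_nonneg_left a1 (Real.exp_pos (-(m:ℝ))).le
        linarith
      nlinarith
  calc _ ≤ Real.exp m * (1 + Real.exp (1 / 2)) / (c * max 1 (Real.exp (m - z.re)) * (1 + Real.exp m)) := by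
        gcongr
    _ ≤ _ := by
        rw [div_le_iff₀ hD]
        calc _ ≤ (3 * Real.exp (-(1 * |(m : ℝ)|)) * (max 1 (Real.exp (m - z.re)) * (1 + Real.exp m))) * (1 + Real.exp (1 / 2)) := by gcongr
          _ = _ := by field_simp

theorem sig_tsum_ne : ∃ θ : ℝ, 0 < θ ∧ θ < 1 / 2 ∧
    Summable (fun m : ℤ => sigmoid (θ - m) - sigmoid (-m)) ∧
    ∑' m : ℤ, (sigmoid (θ - m) - sigmoid (-m)) ≠ θ := by
  obtain ⟨K, hK⟩ := tc_bound
  have hsum := (summable_exp_int 1 one_pos).mul_left K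
  set U : Set ℂ := {z | |z.re| < 1 / 2} with hU
  have hUo : IsOpen U := isOpen_lt (by fun_prop) continuous_const
  have hUc : IsPreconnected U := by
    have : U = Complex.re ⁻¹' (Ioo (-(1/2)) (1/2)) := by
      ext z; simp [hU, abs_lt]
    rw [this]
    exact ((convex_Ioo _ _).linear_preimage Complex.reLm).isPreconnected
  have hdiff : DifferentiableOn ℂ (fun z => ∑' m : ℤ, tc m z) U := by
    refine Complex.differentiableOn_tsum_of_summable_norm hsum ?_ hUo (fun m z hz => hK m z hz)
    intro m z hz
    apply DifferentiableAt.differentiableWithinAt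
    unfold tc
    by_cases hm : m = 0
    · simp [hm]
    · simp only [hm, if_false]
      have := tc_den m hm z hz
      fun_prop (disch := assumption)
  -- real terms
  have hreal : ∀ (y : ℝ) (m : ℤ), m ≠ 0 →
      tc m y = ((sigmoid (y - m) - sigmoid (-m) : ℝ) : ℂ) := by
    intro y m hm
    unfold tc sigmoid
    simp only [hm, if_false]
    push_cast
    simp
  have hsumR : ∀ y : ℝ, |y| < 1 / 2 → Summable (fun m : ℤ => sigmoid (y - m) - sigmoid (-m)) := by
    intro y hy
    have h0 : Summable (fun m : ℤ => tc m y) :=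
      Summable.of_norm_bounded hsum (fun m => hK m y (by simpa using hy))
    have h1 : Summable (fun m : ℤ => (tc m y).re) := Complex.reCLM.summable h0
    rw [← Finset.summable_compl_iff {(0 : ℤ)}] at h1 ⊢
    refine h1.congr fun m => ?_
    have : (m : ℤ) ≠ 0 := by have := m.2; simpa using this
    rw [hreal y m this, Complex.ofReal_re]
  by_contra hcon
  push Not at hcon
  have hB : ∀ y : ℝ, 0 < y → y < 1 / 2 →
      (∑' m : ℤ, tc m y) = ((y - (sigmoid y - 1 / 2) : ℝ) : ℂ) := by
    intro y h0 h1
    have hy : |y| < 1 / 2 := by rw [abs_of_pos h0]; exact h1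
    have hs := hsumR y hy
    have h2 := hcon y h0 h1 hs
    rw [hs.tsum_eq_add_tsum_ite 0] at h2
    have h3 : (∑' m : ℤ, tc m y) =
        ((∑' m : ℤ, if m = 0 then 0 else sigmoid (y - m) - sigmoid (-m) : ℝ) : ℂ) := by
      rw [Complex.ofReal_tsum]
      congr 1; ext m
      split_ifs with hm
      · simp [tc, hm]
      · exact hreal y m hm
    rw [h3]
    congr 1
    have h4 : sigmoid (-((0 : ℤ) : ℝ)) = 1 / 2 := by simp [sigmoid]; norm_num
    rw [h4] at h2
    simp only [Int.cast_zero, sub_zero] at h2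
    linarith
  set h : ℂ → ℂ := fun z => (1 + Complex.exp z) * ((∑' m : ℤ, tc m z) - z - 1 / 2) + Complex.exp z
    with hh
  have hhan : AnalyticOnNhd ℂ h U := by
    apply DifferentiableOn.analyticOnNhd _ hUo
    have e : DifferentiableOn ℂ Complex.exp U := Complex.differentiable_exp.differentiableOn
    exact (((differentiableOn_const 1).add e).mul
      ((hdiff.sub differentiableOn_id).sub (differentiableOn_const _))).add e
  have hz : ∀ y : ℝ, 0 < y → y < 1 / 2 → h y = 0 := by
    intro y h0 h1
    simp only [hh]
    rw [hB y h0 h1]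
    have : sigmoid y * (1 + Real.exp y) = Real.exp y := by
      unfold sigmoid
      have h : Real.exp (-y) * Real.exp y = 1 := by rw [← Real.exp_add]; simp
      have := Real.exp_pos (-y)
      field_simp
      nlinarith
    have h3 : (1 + Real.exp y) * ((y - (sigmoid y - 1 / 2)) - y - 1 / 2) + Real.exp y = 0 := by
      linarith
    have h4 := congrArg (fun r : ℝ => (r : ℂ)) h3
    push_cast at h4 ⊢
    exact h4
  have hfreq : ∃ᶠ z in nhdsWithin ((1 / 4 : ℝ) : ℂ) {((1 / 4 : ℝ) : ℂ)}ᶜ, h z = 0 := by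
    have ht : Filter.Tendsto (fun y : ℝ => (y : ℂ)) (nhdsWithin (1 / 4 : ℝ) {(1 / 4 : ℝ)}ᶜ)
        (nhdsWithin ((1 / 4 : ℝ) : ℂ) {((1 / 4 : ℝ) : ℂ)}ᶜ) := by
      refine tendsto_nhdsWithin_of_tendsto_nhds_of_eventually_within _ ?_ ?_
      · exact (Complex.continuous_ofReal.tendsto _).mono_left nhdsWithin_le_nhds
      · filter_upwards [self_mem_nhdsWithin] with y hy
        simpa only [mem_compl_iff, mem_singleton_iff, Complex.ofReal_inj] using hy
    refine ht.frequently ?_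
    apply Filter.Eventually.frequently
    apply nhdsWithin_le_nhds
    filter_upwards [Ioo_mem_nhds (show (0:ℝ) < 1 / 4 by norm_num) (show (1/4:ℝ) < 1 / 2 by norm_num)]
      with y hy
    exact hz y hy.1 hy.2
  have hzero := hhan.eqOn_zero_of_preconnected_of_frequently_eq_zero hUc
    (z₀ := ((1 / 4 : ℝ) : ℂ)) (by
      simp only [hU, Set.mem_ofPred_eq, Complex.ofReal_re]; rw [abs_of_pos] <;> norm_num) hfreq
  have := hzero (x := Real.pi * Complex.I) (by simp [hU])
  simp [hh, Complex.exp_pi_mul_I] at this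

theorem sf_tsum_ne : ∃ θ : ℝ, 0 < θ ∧ θ < 1 ∧ ∃ W : ℝ, W ≠ θ ∧
    HasSum (fun m : ℤ => sf (θ - m) - sf (-m)) W := by
  obtain ⟨θ, h0, h1, hs, hne⟩ := sig_tsum_ne
  refine ⟨θ, h0, by linarith, _, hne, ?_⟩
  have H := hs.hasSum
  have H2 := (Equiv.hasSum_iff (Equiv.subRight (1 : ℤ))).2 H
  have H3 := (H.add H2).div_const 2
  rw [add_self_div_two] at H3
  have e : (fun m : ℤ => sf (θ - m) - sf (-m)) = (fun i : ℤ =>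
      (sigmoid (θ - i) - sigmoid (-i) +
        ((fun m : ℤ => sigmoid (θ - m) - sigmoid (-m)) ∘ (Equiv.subRight (1 : ℤ))) i) / 2) := by
    ext m
    simp only [sf, Function.comp, Equiv.subRight_apply]
    push_cast
    rw [show θ - (m : ℝ) + 1 = θ - (m - 1) by ring, show -(m : ℝ) + 1 = -(m - 1) by ring]
    ring
  rw [e]
  exact H3
/-! ### Summation by parts -/

noncomputable def Lop (b : ℕ → ℝ) (J : ℕ) (x : ℝ) : ℝ :=
  b 0 + ∑ j ∈ Finset.range J, (b (j + 1) - b j) * sf (x - (j + 1))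

theorem Lop_succ (b : ℕ → ℝ) (J : ℕ) (x : ℝ) :
    Lop b (J + 1) x = Lop b J x + (b (J + 1) - b J) * sf (x - (J + 1)) := by
  unfold Lop; rw [Finset.sum_range_succ]; ring

theorem sum_phi (b : ℕ → ℝ) (J : ℕ) (x : ℝ) :
    ∑ j ∈ Finset.range (J + 1), b j * phi (x - j) =
      Lop b J x + b 0 * (sf x - 1) - b J * sf (x - (J + 1)) := by
  induction J with
  | zero => simp [Lop, phi_eq]; ring
  | succ J ih =>
    rw [Finset.sum_range_succ, ih, Lop_succ, phi_eq]
    push_cast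
    rw [show x - (J + 1) - 1 = x - ((J : ℝ) + 1 + 1) by ring]
    ring

theorem Lop_sub (b c : ℕ → ℝ) (J : ℕ) (x : ℝ) :
    Lop b J x - Lop c J x = Lop (fun j => b j - c j) J x := by
  unfold Lop
  rw [add_sub_add_comm, ← Finset.sum_sub_distrib]
  congr 1
  apply Finset.sum_congr rfl
  intros; ring

theorem Lop_le (b : ℕ → ℝ) (J : ℕ) (x e : ℝ) (h : ∀ j, |b j| ≤ e) : |Lop b J x| ≤ e := by
  have key : |Lop b J x - b J * sf (x - (J + 1))| ≤ e * (1 - sf (x - (J + 1))) := by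
    induction J with
    | zero =>
      have : Lop b 0 x - b 0 * sf (x - ((0 : ℕ) + 1)) = b 0 * (1 - sf (x - ((0 : ℕ) + 1))) := by
        simp [Lop]; ring
      have hp : 0 < 1 - sf (x - ((0 : ℕ) + 1)) := by linarith [sf_lt_one (x - ((0 : ℕ) + 1))]
      rw [this, abs_mul, abs_of_pos hp]
      exact mul_le_mul_of_nonneg_right (h 0) hp.le
    | succ J ih =>
      have hm : sf (x - ((J + 1 : ℕ) + 1)) ≤ sf (x - (J + 1)) := sf_mono (by push_cast; linarith)
      have : Lop b (J + 1) x - b (J + 1) * sf (x - ((J + 1 : ℕ) + 1)) =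
          (Lop b J x - b J * sf (x - (J + 1))) +
            b (J + 1) * (sf (x - (J + 1)) - sf (x - ((J + 1 : ℕ) + 1))) := by
        rw [Lop_succ]; ring
      rw [this]
      refine (abs_add_le _ _).trans ?_
      rw [abs_mul (b (J + 1)), abs_of_nonneg (sub_nonneg.2 hm)]
      have := mul_le_mul_of_nonneg_right (h (J + 1)) (sub_nonneg.2 hm)
      linarith
  have h1 : |b J * sf (x - (J + 1))| ≤ e * sf (x - (J + 1)) := by
    rw [abs_mul, abs_of_pos (sf_pos _)]
    exact mul_le_mul_of_nonneg_right (h J) (sf_pos _).le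
  have h2 := abs_add_le (Lop b J x - b J * sf (x - (J + 1))) (b J * sf (x - (J + 1)))
  rw [sub_add_cancel] at h2
  linarith

noncomputable def LopD (b : ℕ → ℝ) (J : ℕ) (x : ℝ) : ℝ :=
  ∑ j ∈ Finset.range J, (b (j + 1) - b j) * sfD (x - (j + 1))

noncomputable def LopDD (b : ℕ → ℝ) (J : ℕ) (x : ℝ) : ℝ :=
  ∑ j ∈ Finset.range J, (b (j + 1) - b j) * sfDD (x - (j + 1))

theorem Lop_deriv (b : ℕ → ℝ) (J : ℕ) (x : ℝ) : HasDerivAt (Lop b J) (LopD b J x) x := by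
  unfold Lop LopD
  refine HasDerivAt.const_add _ ?_
  refine HasDerivAt.fun_sum fun j _ => ?_
  exact ((sf_deriv _).comp_sub_const x ((j : ℝ) + 1)).const_mul _

theorem LopD_deriv (b : ℕ → ℝ) (J : ℕ) (x : ℝ) : HasDerivAt (LopD b J) (LopDD b J x) x := by
  unfold LopDD LopD
  refine HasDerivAt.fun_sum fun j _ => ?_
  exact ((sfD_deriv _).comp_sub_const x ((j : ℝ) + 1)).const_mul _

theorem lop_aux (K : ℝ) (hK : ∀ (S : Finset ℕ) (x : ℝ), ∑ j ∈ S, Real.exp (-(|x - j| / 2)) ≤ K)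
    (u : ℝ → ℝ) (hu : ∀ x, |u x| ≤ 3 * Real.exp (-|x|)) (a : ℕ → ℝ) (J : ℕ) (d : ℝ) (hd : 0 ≤ d)
    (ha : ∀ j < J, |a j| ≤ d) (x : ℝ) :
    |∑ j ∈ Finset.range J, a j * u (x - (j + 1))| ≤ 3 * K * d := by
  refine (Finset.abs_sum_le_sum_abs _ _).trans ?_
  have h1 : ∀ j ∈ Finset.range J, |a j * u (x - (j + 1))| ≤
      3 * d * Real.exp (-(|(x - 1) - j| / 2)) := by
    intro j hj
    rw [abs_mul]
    have h2 := hu (x - (j + 1))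
    have h3 : Real.exp (-|x - (j + 1)|) ≤ Real.exp (-(|(x - 1) - j| / 2)) := by
      apply Real.exp_le_exp.2
      rw [show x - ((j : ℝ) + 1) = x - 1 - j by ring]
      linarith [abs_nonneg (x - 1 - j)]
    calc _ ≤ d * (3 * Real.exp (-(|(x - 1) - j| / 2))) := by
          apply mul_le_mul (ha j (Finset.mem_range.1 hj)) (by linarith) (abs_nonneg _) hd
      _ = _ := by ring
  refine (Finset.sum_le_sum h1).trans ?_
  rw [← Finset.mul_sum]
  have := mul_le_mul_of_nonneg_left (hK (Finset.range J) (x - 1)) (by positivity : 0 ≤ 3 * d)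
  linarith

theorem lip_of_deriv (F F' : ℝ → ℝ) (hF : ∀ x, HasDerivAt F (F' x) x) (C : ℝ)
    (hC : ∀ x, |F' x| ≤ C) (x y : ℝ) : |F y - F x| ≤ C * |y - x| := by
  have := convex_univ.norm_image_sub_le_of_norm_hasDerivWithin_le (f := F) (f' := F') (C := C)
    (x := x) (y := y) (fun x _ => (hF x).hasDerivWithinAt) (fun x _ => hC x) trivial trivial
  simpa using this

theorem taylor_aux (F F' : ℝ → ℝ) (hF : ∀ x, HasDerivAt F (F' x) x) (C : ℝ) (hC0 : 0 ≤ C)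
    (hC : ∀ x y, |F' y - F' x| ≤ C * |y - x|) (y a b : ℝ) :
    |F b - F a - (b - a) * F' y| ≤ C * (|a - y| + |b - a|) * |b - a| := by
  have := (convex_uIcc a b).norm_image_sub_le_of_norm_hasDerivWithin_le
    (f := fun x => F x - x * F' y) (f' := fun x => F' x - 1 * F' y)
    (C := C * (|a - y| + |b - a|)) (x := a) (y := b)
    (fun x _ => ((hF x).sub ((hasDerivAt_id x).mul_const _)).hasDerivWithinAt)
    (fun x hx => by
      rw [one_mul, Real.norm_eq_abs]
      refine (hC y x).trans ?_
      refine mul_le_mul_of_nonneg_left ?_ hC0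
      have h1 := abs_add_le (x - a) (a - y)
      have h2 : |x - a| ≤ |b - a| := abs_sub_left_of_mem_uIcc hx
      rw [sub_add_sub_cancel] at h1
      linarith) left_mem_uIcc right_mem_uIcc
  simp only [Real.norm_eq_abs] at this
  convert this using 2
  ring

/-! ### Grid values -/

noncomputable def cl (u : ℝ) : ℝ := max (-1) (min 1 u)

theorem cl_mem (u : ℝ) : cl u ∈ Icc (-1 : ℝ) 1 := by
  unfold cl
  exact ⟨le_max_left _ _, max_le (by norm_num) (min_le_left _ _)⟩

theorem beta_eq (N : ℕ) (hN : 1 ≤ N) (g : ℝ → ℝ) (j : ℕ) :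
    beta N g j = g (cl (((j : ℝ) - 2 * N) / N)) := by
  have hN' : (0 : ℝ) < N := by exact_mod_cast hN
  unfold beta cl
  split_ifs with h1 h2
  · have : (j : ℝ) + 1 ≤ N := by exact_mod_cast (by omega : j + 1 ≤ N)
    have h : ((j : ℝ) - 2 * N) / N ≤ -1 := by rw [div_le_iff₀ hN']; linarith
    rw [min_eq_right (by linarith), max_eq_left h]
  · have a1 : (N : ℝ) ≤ j := by exact_mod_cast (by omega : N ≤ j)
    have a2 : (j : ℝ) ≤ 3 * N := by exact_mod_cast h2
    rw [min_eq_right (by rw [div_le_iff₀ hN']; linarith),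
      max_eq_right (by rw [le_div_iff₀ hN']; linarith)]
  · have a2 : 3 * (N : ℝ) ≤ j := by exact_mod_cast (by omega : 3 * N ≤ j)
    rw [min_eq_left (by rw [le_div_iff₀ hN']; linarith), max_eq_right (by norm_num)]

theorem beta_mid (N : ℕ) (hN : 1 ≤ N) (g : ℝ → ℝ) (j : ℕ) (h1 : N ≤ j) (h2 : j ≤ 3 * N) :
    beta N g j = g (((j : ℝ) - 2 * N) / N) := by
  unfold beta
  rw [if_neg (by omega), if_pos h2]

theorem grid_mem (N : ℕ) (hN : 1 ≤ N) (x : ℝ) (h1 : N ≤ x) (h2 : x ≤ 3 * N) :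
    (x - 2 * N) / N ∈ Icc (-1 : ℝ) 1 := by
  have hN' : (0 : ℝ) < N := by exact_mod_cast hN
  constructor
  · rw [le_div_iff₀ hN']; linarith
  · rw [div_le_iff₀ hN']; linarith

theorem beta_low (N : ℕ) (hN : 1 ≤ N) (g : ℝ → ℝ) (j : ℕ) (h1 : j < N) :
    beta N g (j + 1) - beta N g j = 0 := by
  have hN' : (0 : ℝ) < N := by exact_mod_cast hN
  have e : ∀ i : ℕ, i ≤ N → beta N g i = g (-1) := by
    intro i hi
    rw [beta_eq N hN]
    have : (i : ℝ) ≤ N := by exact_mod_cast hi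
    have h : ((i : ℝ) - 2 * N) / N ≤ -1 := by rw [div_le_iff₀ hN']; linarith
    unfold cl
    rw [min_eq_right (by linarith), max_eq_left h]
  rw [e _ (by omega), e _ (by omega), sub_self]

theorem beta_high (N : ℕ) (hN : 1 ≤ N) (g : ℝ → ℝ) (j : ℕ) (h1 : 3 * N ≤ j) :
    beta N g (j + 1) - beta N g j = 0 := by
  have hN' : (0 : ℝ) < N := by exact_mod_cast hN
  have e : ∀ i : ℕ, 3 * N ≤ i → beta N g i = g 1 := by
    intro i hi
    rw [beta_eq N hN]
    have : 3 * (N : ℝ) ≤ i := by exact_mod_cast hi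
    unfold cl
    rw [min_eq_left (by rw [le_div_iff₀ hN']; linarith), max_eq_right (by norm_num)]
  rw [e _ (by omega), e _ (by omega), sub_self]

/-- the operator with exact partition of unity -/
noncomputable def Sop (k : ℕ) (g : ℝ → ℝ) (t : ℝ) : ℝ := Lop (beta k g) (4 * k) (k * t + 2 * k)

theorem Gop_sub_Sop (k : ℕ) (hk : 1 ≤ k) (g : ℝ → ℝ) (B : ℝ) (hB : ∀ x ∈ Icc (-1 : ℝ) 1, |g x| ≤ B)
    (t : ℝ) (ht : t ∈ Icc (-1 : ℝ) 1) : |Gop k g t - Sop k g t| ≤ 2 * B * Real.exp (-k) := by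
  have hk' : (1 : ℝ) ≤ k := by exact_mod_cast hk
  set x := (k : ℝ) * t + 2 * k with hx
  have hxk : (k : ℝ) ≤ x := by nlinarith [ht.1]
  have hxk3 : x ≤ 3 * k := by nlinarith [ht.2]
  have e : Gop k g t = Sop k g t + beta k g 0 * (sf x - 1)
      - beta k g (4 * k) * sf (x - ((4 * k : ℕ) + 1)) := by
    unfold Gop Sop
    rw [← hx, ← sum_phi]
    apply Finset.sum_congr rfl
    intro j _
    rw [hx]; congr 2; ring
  have hb : ∀ j, |beta k g j| ≤ B := fun j => by rw [beta_eq k hk]; exact hB _ (cl_mem _)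
  have h1 : |sf x - 1| ≤ Real.exp (-k) := by
    rw [abs_sub_comm, abs_of_pos (by linarith [sf_lt_one x])]
    have a1 := sig_le_exp (-x)
    have a2 := sig_mono (show x ≤ x + 1 by linarith)
    have a3 : Real.exp (-x) ≤ Real.exp (-k) := Real.exp_le_exp.2 (by linarith)
    rw [sig_neg] at a1
    unfold sf; linarith
  have h2 : |sf (x - ((4 * k : ℕ) + 1))| ≤ Real.exp (-k) := by
    rw [abs_of_pos (sf_pos _)]
    set y := x - ((4 * k : ℕ) + 1) with hy
    have hy1 : y ≤ -k - 1 := by rw [hy]; push_cast; linarith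
    have a1 := sig_le_exp (y + 1)
    have a2 := sig_mono (show y ≤ y + 1 by linarith)
    have a3 : Real.exp (y + 1) ≤ Real.exp (-k) := Real.exp_le_exp.2 (by linarith)
    unfold sf; linarith
  have hB0 : 0 ≤ B := (abs_nonneg _).trans (hb 0)
  rw [e, show Sop k g t + beta k g 0 * (sf x - 1)
      - beta k g (4 * k) * sf (x - ((4 * k : ℕ) + 1)) - Sop k g t = beta k g 0 * (sf x - 1)
      - beta k g (4 * k) * sf (x - ((4 * k : ℕ) + 1)) by ring]
  refine (abs_sub _ _).trans ?_
  rw [abs_mul, abs_mul]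
  have := mul_le_mul (hb 0) h1 (abs_nonneg _) hB0
  have := mul_le_mul (hb (4 * k)) h2 (abs_nonneg _) hB0
  linarith
/-! ### Local lower estimate -/

theorem Sop_error (k M : ℕ) (hk : 1 ≤ k) (hM : 1 ≤ M) (g : ℝ → ℝ) (e : ℝ)
    (h1 : ∀ t ∈ Icc (-1 : ℝ) 1, |Sop k g t - g t| ≤ e)
    (h2 : ∀ t ∈ Icc (-1 : ℝ) 1, |Sop (M * k) g t - g t| ≤ e)
    (t : ℝ) (ht : t ∈ Icc (-1 : ℝ) 1) :
    |Sop (M * k) (Sop k g) t - Sop k g t| ≤ 3 * e := by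
  have hN : 1 ≤ M * k := Nat.mul_pos hM hk
  have h3 : |Sop (M * k) (Sop k g) t - Sop (M * k) g t| ≤ e := by
    unfold Sop
    rw [Lop_sub]
    apply Lop_le
    intro j
    rw [beta_eq _ hN, beta_eq _ hN]
    exact h1 _ (cl_mem _)
  have a1 := h1 t ht
  have a2 := h2 t ht
  rw [abs_le] at *
  constructor <;> linarith

theorem weight_bound (m : ℝ) (j p : ℝ) (hm : m = j + 1 - p) :
    (|j - p| + 1) * (9 * Real.exp (-|m|)) ≤ 36 * Real.exp (-(|(p - 1) - j| / 2)) := by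
  have e1 : |(p - 1) - j| = |m| := by rw [hm, ← abs_neg]; congr 1; ring
  rw [e1]
  have h1 : |j - p| ≤ |m| + 1 := by
    have := abs_add_le m (-1)
    rw [abs_neg, abs_one] at this
    rwa [show m + -1 = j - p by rw [hm]; ring] at this
  have h2 : Real.exp (-|m|) = Real.exp (-(|m| / 2)) * Real.exp (-(|m| / 2)) := by
    rw [← Real.exp_add]; congr 1; ring
  have h3 := Real.add_one_le_exp (|m| / 2)
  have h4 : Real.exp (-(|m| / 2)) * Real.exp (|m| / 2) = 1 := by rw [← Real.exp_add]; simp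
  have h5 := Real.exp_pos (-(|m| / 2))
  have h6 : (|m| / 2 + 1) * Real.exp (-(|m| / 2)) ≤ 1 := by nlinarith
  have h7 : (|j - p| + 1) * Real.exp (-(|m| / 2)) ≤ 2 := by nlinarith
  rw [h2]
  nlinarith

theorem local_est (K : ℝ)
    (hK : ∀ (S : Finset ℕ) (x : ℝ), ∑ j ∈ S, Real.exp (-(|x - j| / 2)) ≤ K)
    (θ : ℝ) (h0 : 0 < θ) (h1 : θ < 1) (W : ℝ) (R : ℕ)
    (hR : ∀ S : Finset ℤ, Finset.Icc (-(R : ℤ)) R ⊆ S →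
      |∑ m ∈ S, (sf (θ - m) - sf (-m)) - W| ≤ |W - θ| / 2)
    (k M : ℕ) (hk : 1 ≤ k) (hM : 1 ≤ M) (g : ℝ → ℝ) (e : ℝ)
    (hg1 : ∀ t ∈ Icc (-1 : ℝ) 1, |Sop k g t - g t| ≤ e)
    (hg2 : ∀ t ∈ Icc (-1 : ℝ) 1, |Sop (M * k) g t - g t| ≤ e)
    (C : ℝ) (hC0 : 0 ≤ C)
    (hC : ∀ x y, |LopD (beta k g) (4 * k) y - LopD (beta k g) (4 * k) x| ≤ C * |y - x|)
    (p : ℕ) (hp1 : M * k + R + 1 ≤ p) (hp2 : p + R + 1 ≤ 3 * (M * k)) :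
    |LopD (beta k g) (4 * k) (p / M)| / M * (|W - θ| / 2) ≤ 6 * e + C / M ^ 2 * (36 * K + 1) := by
  set N := M * k with hNdef
  have hN : 1 ≤ N := Nat.mul_pos hM hk
  have hN' : (0 : ℝ) < N := by exact_mod_cast hN
  have hM' : (0 : ℝ) < M := by exact_mod_cast hM
  have hk' : (0 : ℝ) < k := by exact_mod_cast hk
  have hNM : (N : ℝ) = M * k := by rw [hNdef]; push_cast; rfl
  set F := Lop (beta k g) (4 * k) with hF
  set A := LopD (beta k g) (4 * k) (p / M) with hA
  set f := Sop k g with hf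
  have hfF : ∀ x : ℝ, f ((x - 2 * N) / N) = F (x / M) := by
    intro x
    rw [hf, Sop, ← hF]
    congr 1
    rw [hNM]; field_simp; ring
  have hpN : (N : ℝ) + R + 1 ≤ p := by exact_mod_cast hp1
  have hpN3 : (p : ℝ) + R + 1 ≤ 3 * N := by exact_mod_cast hp2
  have hR0 : (0 : ℝ) ≤ R := Nat.cast_nonneg R
  -- values at the two points
  have val : ∀ x : ℝ, N ≤ x → x ≤ 3 * N → |Lop (beta N f) (4 * N) x - F (x / M)| ≤ 3 * e := by
    intro x hx1 hx2
    have := Sop_error k M hk hM g e hg1 hg2 _ (grid_mem N hN x hx1 hx2)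
    rw [← hNdef, ← hf, hfF, Sop] at this
    rwa [show (N : ℝ) * ((x - 2 * N) / N) + 2 * N = x by field_simp; ring] at this
  have v1 := val p (by linarith) (by linarith)
  have v2 := val (p + θ) (by linarith) (by linarith)
  set w : ℤ → ℝ := fun m => sf (θ - m) - sf (-m) with hw
  have hdiff : Lop (beta N f) (4 * N) (p + θ) - Lop (beta N f) (4 * N) p =
      ∑ j ∈ Finset.Ico N (3 * N), (F (((j : ℝ) + 1) / M) - F (j / M)) * w ((j : ℤ) + 1 - p) := by
    unfold Lop
    rw [add_sub_add_left_eq_sub, ← Finset.sum_sub_distrib]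
    have hsub : Finset.Ico N (3 * N) ⊆ Finset.range (4 * N) := by
      intro j hj
      rw [Finset.mem_Ico] at hj
      rw [Finset.mem_range]; omega
    rw [← Finset.sum_subset hsub]
    · apply Finset.sum_congr rfl
      intro j hj
      rw [Finset.mem_Ico] at hj
      rw [beta_mid N hN f j hj.1 (by omega), beta_mid N hN f (j + 1) (by omega) (by omega),
        hfF, hfF, hw]
      push_cast
      rw [show (p : ℝ) + θ - (j + 1) = θ - (j + 1 - p) by ring,
        show (p : ℝ) - (j + 1) = -(j + 1 - p) by ring]
      ring
    · intro j hj1 hj2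
      rw [Finset.mem_Ico] at hj2
      have hz : beta N f (j + 1) - beta N f j = 0 := by
        by_cases hjN : j < N
        · exact beta_low N hN f j hjN
        · exact beta_high N hN f j (by omega)
      rw [hz]; ring
  -- the sum of the weights
  have hsumw : |∑ j ∈ Finset.Ico N (3 * N), w ((j : ℤ) + 1 - p) - W| ≤ |W - θ| / 2 := by
    have hinj : Set.InjOn (fun j : ℕ => (j : ℤ) + 1 - p) (Finset.Ico N (3 * N)) := by
      intro a _ b _ h; simpa using h
    rw [← Finset.sum_image (s := Finset.Ico N (3 * N)) (g := fun j : ℕ => (j : ℤ) + 1 - p)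
      (f := w) hinj]
    apply hR
    intro m hm
    rw [Finset.mem_Icc] at hm
    rw [Finset.mem_image]
    refine ⟨(m + p - 1).toNat, ?_, ?_⟩
    · rw [Finset.mem_Ico]; omega
    · omega
  -- errors
  have herr : |∑ j ∈ Finset.Ico N (3 * N),
      (F (((j : ℝ) + 1) / M) - F (j / M) - A / M) * w ((j : ℤ) + 1 - p)| ≤ C / M ^ 2 * (36 * K) := by
    refine (Finset.abs_sum_le_sum_abs _ _).trans ?_
    have hj : ∀ j ∈ Finset.Ico N (3 * N),
        |(F (((j : ℝ) + 1) / M) - F (j / M) - A / M) * w ((j : ℤ) + 1 - p)| ≤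
          C / M ^ 2 * (36 * Real.exp (-(|((p : ℝ) - 1) - j| / 2))) := by
      intro j _
      rw [abs_mul]
      have t1 := taylor_aux F _ (Lop_deriv (beta k g) (4 * k)) C hC0 hC (p / M) (j / M) ((j + 1) / M)
      rw [← hA] at t1
      have q1 : ((j : ℝ) + 1) / M - j / M = 1 / M := by field_simp; ring
      have q2 : |(j : ℝ) / M - p / M| = |(j : ℝ) - p| / M := by
        rw [← sub_div, abs_div, abs_of_pos hM']
      rw [q1, q2, abs_of_pos (by positivity : 0 < 1 / (M : ℝ))] at t1
      rw [show 1 / (M : ℝ) * A = A / M by ring] at t1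
      have t2 : |w ((j : ℤ) + 1 - p)| ≤ 9 * Real.exp (-|(j : ℝ) + 1 - p|) := by
        have := sf_diff_le θ ((j : ℝ) + 1 - p) h0.le h1.le
        rw [hw]; push_cast; exact this
      have t3 := weight_bound ((j : ℝ) + 1 - p) j p rfl
      calc _ ≤ (C * (|(j : ℝ) - p| / M + 1 / M) * (1 / M)) * (9 * Real.exp (-|(j : ℝ) + 1 - p|)) :=
            mul_le_mul t1 t2 (abs_nonneg _) (by positivity)
        _ = C / M ^ 2 * ((|(j : ℝ) - p| + 1) * (9 * Real.exp (-|(j : ℝ) + 1 - p|))) := by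
            field_simp
        _ ≤ _ := mul_le_mul_of_nonneg_left t3 (by positivity)
    refine (Finset.sum_le_sum hj).trans ?_
    rw [← Finset.mul_sum, ← Finset.mul_sum]
    have := hK (Finset.Ico N (3 * N)) ((p : ℝ) - 1)
    gcongr
  have herr2 : |F (((p : ℝ) + θ) / M) - F (p / M) - θ * (A / M)| ≤ C / M ^ 2 := by
    have t1 := taylor_aux F _ (Lop_deriv (beta k g) (4 * k)) C hC0 hC (p / M) (p / M) ((p + θ) / M)
    rw [← hA] at t1
    have q1 : ((p : ℝ) + θ) / M - p / M = θ / M := by field_simp; ring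
    rw [q1, sub_self, abs_zero, zero_add, abs_of_pos (by positivity : 0 < θ / (M : ℝ))] at t1
    rw [show θ / (M : ℝ) * A = θ * (A / M) by ring] at t1
    refine t1.trans ?_
    rw [show C * (θ / M) * (θ / M) = C / M ^ 2 * (θ * θ) by field_simp]
    have : θ * θ ≤ 1 := by nlinarith
    have h9 : 0 ≤ C / (M : ℝ) ^ 2 := by positivity
    nlinarith
  have hsplit : ∑ j ∈ Finset.Ico N (3 * N), (F (((j : ℝ) + 1) / M) - F (j / M)) * w ((j : ℤ) + 1 - p)
      = ∑ j ∈ Finset.Ico N (3 * N),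
      (F (((j : ℝ) + 1) / M) - F (j / M) - A / M) * w ((j : ℤ) + 1 - p)
      + A / M * ∑ j ∈ Finset.Ico N (3 * N), w ((j : ℤ) + 1 - p) := by
    rw [Finset.mul_sum, ← Finset.sum_add_distrib]
    apply Finset.sum_congr rfl
    intros; ring
  rw [hsplit] at hdiff
  set σw := ∑ j ∈ Finset.Ico N (3 * N), w ((j : ℤ) + 1 - p) with hσ
  have hlow : |W - θ| / 2 ≤ |σw - θ| := by
    have := abs_sub_abs_le_abs_sub (W - θ) (W - σw)
    rw [show W - θ - (W - σw) = σw - θ by ring, abs_sub_comm W σw] at this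
    linarith
  have hmain : |A / M * (σw - θ)| ≤ 6 * e + C / M ^ 2 * (36 * K + 1) := by
    rw [abs_le] at *
    constructor <;> nlinarith
  rw [abs_mul, abs_div, abs_of_pos hM'] at hmain
  exact (mul_le_mul_of_nonneg_left hlow (by positivity)).trans hmain
/-! ### Strong converse estimate -/

set_option maxHeartbeats 2000000 in
theorem core : ∃ M : ℕ, 1 ≤ M ∧ ∃ C : ℝ, 0 < C ∧ ∀ (g : ℝ → ℝ) (k : ℕ), 1 ≤ k → ∀ e : ℝ,
    (∀ t ∈ Icc (-1 : ℝ) 1, |Sop k g t - g t| ≤ e) →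
    (∀ t ∈ Icc (-1 : ℝ) 1, |Sop (M * k) g t - g t| ≤ e) →
    ∀ x ∈ Icc (-1 : ℝ) 1, ∀ y ∈ Icc (-1 : ℝ) 1, |y - x| ≤ 1 / k → |g x - g y| ≤ C * e := by
  obtain ⟨K, hK1, hK⟩ := exp_sum_bound
  obtain ⟨θ, h0, h1, W, hW, hS⟩ := sf_tsum_ne
  set κ := |W - θ| with hκ
  have hκ0 : 0 < κ := abs_pos.2 (sub_ne_zero.2 hW)
  obtain ⟨R, hR⟩ : ∃ R : ℕ, ∀ S : Finset ℤ, Finset.Icc (-(R : ℤ)) R ⊆ S →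
      |∑ m ∈ S, (sf (θ - m) - sf (-m)) - W| ≤ κ / 2 := by
    have hev := (Metric.tendsto_nhds.1 hS) (κ / 2) (by positivity)
    obtain ⟨S0, hS0⟩ := Filter.eventually_atTop.1 hev
    refine ⟨S0.sup Int.natAbs, fun S hS' => ?_⟩
    have := hS0 S (fun m hm => hS' (by
      have := Finset.le_sup (f := Int.natAbs) hm
      rw [Finset.mem_Icc]; omega))
    rw [Real.dist_eq] at this
    exact this.le
  obtain ⟨M, hM⟩ := exists_nat_ge (6 * K * (R + 2) + 24 * K * (36 * K + 1) / κ)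
  have hR0 : (0 : ℝ) ≤ R := Nat.cast_nonneg R
  have hMa : 6 * K * (R + 2) ≤ M := by
    have : 0 ≤ 24 * K * (36 * K + 1) / κ := by positivity
    linarith
  have hMb : 24 * K * (36 * K + 1) ≤ M * κ := by
    have h2 : 0 ≤ 6 * K * (R + 2) := by positivity
    have : 24 * K * (36 * K + 1) / κ ≤ M := by linarith
    rwa [div_le_iff₀ hκ0] at this
  have hMR : 2 * R + 2 ≤ M := by
    have : (2 * (R : ℝ) + 2) ≤ M := by nlinarith
    exact_mod_cast this
  have hM1 : 1 ≤ M := by omega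
  have hM' : (0 : ℝ) < M := by exact_mod_cast hM1
  refine ⟨M, hM1, 3 * K * (48 * M / κ + 8) + 2, by positivity, ?_⟩
  intro g k hk e hg1 hg2 x hx y hy hxy
  have hk' : (0 : ℝ) < k := by exact_mod_cast hk
  have he0 : 0 ≤ e := (abs_nonneg _).trans (hg1 x hx)
  set b := beta k g with hb
  obtain ⟨j0, hj0, hmax⟩ := Finset.exists_max_image (Finset.Ico k (3 * k))
    (fun j => |b (j + 1) - b j|) ⟨k, by rw [Finset.mem_Ico]; omega⟩
  rw [Finset.mem_Ico] at hj0
  set d := |b (j0 + 1) - b j0| with hd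
  have hd0 : 0 ≤ d := abs_nonneg _
  have hall : ∀ j < 4 * k, |b (j + 1) - b j| ≤ d := by
    intro j _
    by_cases c1 : j < k
    · rw [hb, beta_low k hk g j c1, abs_zero]; exact hd0
    · by_cases c2 : 3 * k ≤ j
      · rw [hb, beta_high k hk g j c2, abs_zero]; exact hd0
      · exact hmax j (by rw [Finset.mem_Ico]; omega)
  have hF1 : ∀ x, |LopD b (4 * k) x| ≤ 3 * K * d :=
    lop_aux K hK sfD sfD_le _ (4 * k) d hd0 hall
  have hF2 : ∀ x, |LopDD b (4 * k) x| ≤ 3 * K * d :=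
    lop_aux K hK sfDD sfDD_le _ (4 * k) d hd0 hall
  have hL1 := lip_of_deriv _ _ (Lop_deriv b (4 * k)) _ hF1
  have hL2 := lip_of_deriv _ _ (LopD_deriv b (4 * k)) _ hF2
  -- grid values of F
  have hgrid : ∀ j : ℕ, k ≤ j → j ≤ 3 * k → |Lop b (4 * k) j - b j| ≤ e := by
    intro j a1 a2
    have := hg1 _ (grid_mem k hk j (by exact_mod_cast a1) (by exact_mod_cast a2))
    rw [Sop, show (k : ℝ) * (((j : ℝ) - 2 * k) / k) + 2 * k = j by field_simp; ring] at this
    rw [hb, beta_mid k hk g j a1 a2]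
    exact this
  obtain ⟨ξ, hξ, hslope⟩ := exists_hasDerivAt_eq_slope (Lop b (4 * k)) (LopD b (4 * k))
    (show (j0 : ℝ) < ((j0 + 1 : ℕ) : ℝ) by push_cast; linarith)
    (fun x _ => (Lop_deriv b (4 * k) x).continuousAt.continuousWithinAt)
    (fun x _ => Lop_deriv b (4 * k) x)
  have hξ1 : d - 2 * e ≤ |LopD b (4 * k) ξ| := by
    rw [hslope, show ((j0 + 1 : ℕ) : ℝ) - j0 = 1 by push_cast; ring, div_one]
    have a1 := hgrid j0 (by omega) (by omega)
    have a2 := hgrid (j0 + 1) (by omega) (by omega)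
    have a3 := abs_sub_abs_le_abs_sub (b (j0 + 1) - b j0)
      (Lop b (4 * k) ((j0 + 1 : ℕ) : ℝ) - Lop b (4 * k) j0)
    have a4 : |b (j0 + 1) - b j0 - (Lop b (4 * k) ((j0 + 1 : ℕ) : ℝ) - Lop b (4 * k) j0)| ≤ 2 * e := by
      rw [abs_le] at a1 a2 ⊢
      constructor <;> linarith [a1.1, a1.2, a2.1, a2.2]
    linarith
  have hξk : (k : ℝ) ≤ ξ := by
    have : (k : ℝ) ≤ j0 := by exact_mod_cast hj0.1
    linarith [hξ.1]
  have hξk3 : ξ ≤ 3 * k := by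
    have : ((j0 + 1 : ℕ) : ℝ) ≤ 3 * k := by exact_mod_cast hj0.2
    linarith [hξ.2]
  -- choice of the base point
  obtain ⟨p, hp1, hp2, hp3⟩ : ∃ p : ℕ, M * k + R + 1 ≤ p ∧ p + R + 1 ≤ 3 * (M * k) ∧
      |(p : ℝ) - M * ξ| ≤ R + 2 := by
    have hNR : 2 * R + 2 ≤ M * k := hMR.trans (Nat.le_mul_of_pos_right M hk)
    have y0 : 0 ≤ M * ξ := by nlinarith
    have q1 := Nat.floor_le y0
    have q2 := Nat.lt_floor_add_one (M * ξ)
    set q := ⌊M * ξ⌋₊ with hq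
    have q3 : M * k ≤ q := Nat.le_floor (by push_cast; nlinarith)
    have q4 : q ≤ 3 * (M * k) := by
      have : (q : ℝ) ≤ 3 * (M * k) := by nlinarith
      exact_mod_cast this
    by_cases hc : q ≤ 2 * (M * k)
    · refine ⟨q + R + 1, by omega, by omega, ?_⟩
      push_cast
      rw [abs_le]; constructor <;> linarith
    · refine ⟨q - (R + 1), by omega, by omega, ?_⟩
      rw [Nat.cast_sub (by omega)]
      push_cast
      rw [abs_le]; constructor <;> linarith
  have hloc := local_est K hK θ h0 h1 W R hR k M hk hM1 g e hg1 hg2 (3 * K * d) (by positivity)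
    hL2 p hp1 hp2
  rw [← hb, ← hκ] at hloc
  have hA : d / 2 - 2 * e ≤ |LopD b (4 * k) (p / M)| := by
    have a1 := hL2 (p / M) ξ
    have a2 : |ξ - p / M| ≤ (R + 2) / M := by
      rw [show ξ - p / M = -((p - M * ξ) / M) by field_simp; ring, abs_neg, abs_div, abs_of_pos hM']
      gcongr
    have a3 : 3 * K * d * ((R + 2) / M) ≤ d / 2 := by
      rw [mul_div_assoc', div_le_iff₀ hM']
      nlinarith
    have a4 := abs_sub_abs_le_abs_sub (LopD b (4 * k) ξ) (LopD b (4 * k) (p / M))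
    have a5 := mul_le_mul_of_nonneg_left a2 (by positivity : 0 ≤ 3 * K * d)
    linarith
  have hdfin : d ≤ (48 * M / κ + 8) * e := by
    have a1 : (d / 2 - 2 * e) / M * (κ / 2) ≤
        6 * e + 3 * K * d / M ^ 2 * (36 * K + 1) := by
      refine le_trans ?_ hloc
      gcongr
    have a2 := mul_le_mul_of_nonneg_left a1 hM'.le
    have a3 : (M : ℝ) * ((d / 2 - 2 * e) / M * (κ / 2)) = (d / 2 - 2 * e) * (κ / 2) := by
      field_simp
    have a4 : (M : ℝ) * (6 * e + 3 * K * d / M ^ 2 * (36 * K + 1)) =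
        6 * e * M + (3 * K * (36 * K + 1)) * d / M := by
      field_simp
    have a5 : (3 * K * (36 * K + 1)) * d / M ≤ κ / 8 * d := by
      rw [div_le_iff₀ hM']
      nlinarith
    rw [a3, a4] at a2
    have a6 : d * κ ≤ 48 * M * e + 8 * κ * e := by nlinarith
    have a7 : (48 * M / κ + 8) * e = (48 * M * e + 8 * κ * e) / κ := by field_simp
    rw [a7, le_div_iff₀ hκ0]
    exact a6
  -- conclusion
  have c1 := hg1 x hx
  have c2 := hg1 y hy
  have c3 : |Sop k g y - Sop k g x| ≤ 3 * K * d := by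
    have := hL1 (k * x + 2 * k) (k * y + 2 * k)
    refine this.trans ?_
    rw [show (k : ℝ) * y + 2 * k - (k * x + 2 * k) = k * (y - x) by ring, abs_mul, abs_of_pos hk']
    have : (k : ℝ) * |y - x| ≤ 1 := by
      rw [le_div_iff₀ hk'] at hxy; linarith
    have h9 : 0 ≤ 3 * K * d := by positivity
    nlinarith
  have c4 : |g x - g y| ≤ 3 * K * d + 2 * e := by
    rw [abs_le] at *
    constructor <;> linarith
  have c5 := mul_le_mul_of_nonneg_left hdfin (by positivity : 0 ≤ 3 * K)
  linarith

/-! ### Conclusion -/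

theorem le_supNorm (h : ℝ → ℝ) (B : ℝ) (hB : ∀ x ∈ Icc (-1 : ℝ) 1, |h x| ≤ B) (x : ℝ)
    (hx : x ∈ Icc (-1 : ℝ) 1) : |h x| ≤ supNorm h := by
  apply le_csSup
  · refine ⟨B, ?_⟩
    rintro v ⟨x, hx, rfl⟩
    exact hB x hx
  · exact ⟨x, hx, rfl⟩

theorem supNorm_le (h : ℝ → ℝ) (B : ℝ) (hB : ∀ x ∈ Icc (-1 : ℝ) 1, |h x| ≤ B) : supNorm h ≤ B := by
  apply csSup_le
  · exact ⟨_, 0, by constructor <;> norm_num, rfl⟩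
  · rintro v ⟨x, hx, rfl⟩
    exact hB x hx

theorem supNorm_nonneg (h : ℝ → ℝ) : 0 ≤ supNorm h := by
  apply Real.sSup_nonneg
  rintro v ⟨x, hx, rfl⟩
  exact abs_nonneg _

theorem modCont_le (g : ℝ → ℝ) (h : ℝ) (c : ℝ) (hc : 0 ≤ c)
    (H : ∀ x ∈ Icc (-1 : ℝ) 1, ∀ y ∈ Icc (-1 : ℝ) 1, |y - x| ≤ h → |g x - g y| ≤ c) :
    modCont g h ≤ c := by
  apply Real.sSup_le _ hc
  rintro v ⟨s, x, hs, hsh, hx, hy, rfl⟩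
  apply H x hx _ hy
  rw [add_sub_cancel_left, abs_of_pos hs]
  exact hsh

theorem Gop_one_bound (g : ℝ → ℝ) (B : ℝ) (hB : ∀ x ∈ Icc (-1 : ℝ) 1, |g x| ≤ B)
    (t : ℝ) (ht : t ∈ Icc (-1 : ℝ) 1) : |Gop 1 g t| ≤ sigmoid 4 * B := by
  have hb : ∀ j, |beta 1 g j| ≤ B := fun j => by
    rw [beta_eq 1 le_rfl]; exact hB _ (cl_mem _)
  have hB0 : 0 ≤ B := (abs_nonneg _).trans (hb 0)
  set x := t + 2 with hx
  have e : Gop 1 g t = ∑ j ∈ Finset.range (4 + 1), beta 1 g j * phi (x - j) := by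
    unfold Gop
    apply Finset.sum_congr rfl
    intro j _
    rw [hx]; congr 2; push_cast; ring
  rw [e]
  have hphi : ∀ y, 0 ≤ phi y := fun y => by
    rw [phi_eq]; linarith [sf_mono (show y - 1 ≤ y by linarith)]
  have h1 : |∑ j ∈ Finset.range (4 + 1), beta 1 g j * phi (x - j)| ≤
      ∑ j ∈ Finset.range (4 + 1), B * phi (x - j) := by
    refine (Finset.abs_sum_le_sum_abs _ _).trans (Finset.sum_le_sum fun j _ => ?_)
    rw [abs_mul, abs_of_nonneg (hphi _)]
    exact mul_le_mul_of_nonneg_right (hb j) (hphi _)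
  have h2 := sum_phi (fun _ => B) 4 x
  rw [h2] at h1
  simp only [Lop, sub_self, zero_mul, Finset.sum_const_zero, add_zero] at h1
  have h3 : sf x ≤ sigmoid 4 := by
    have a1 := sig_mono (show x + 1 ≤ 4 by linarith [ht.2])
    have a2 := sig_mono (show x ≤ 4 by linarith [ht.2])
    unfold sf; linarith
  have h4 := sf_pos (x - ((4 : ℕ) + 1))
  nlinarith [mul_nonneg hB0 h4.le, mul_le_mul_of_nonneg_left h3 hB0]

theorem exp_sum_le (m : ℕ) : ∑ k ∈ Finset.Icc 1 m, Real.exp (-(k : ℝ)) ≤ 1 - Real.exp (-(m : ℝ)) := by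
  induction m with
  | zero => simp
  | succ m ih =>
    rw [Finset.sum_Icc_succ_top (by omega)]
    have h1 : Real.exp (-(m : ℝ)) = Real.exp 1 * Real.exp (-((m + 1 : ℕ) : ℝ)) := by
      rw [← Real.exp_add]; congr 1; push_cast; ring
    have h2 := Real.add_one_le_exp (1 : ℝ)
    have h3 := Real.exp_pos (-((m + 1 : ℕ) : ℝ))
    nlinarith

theorem inverse_theorem :
    ∃ C : ℝ, 0 < C ∧ ∀ g : ℝ → ℝ,
      BddAbove {v : ℝ | ∃ x ∈ Icc (-1 : ℝ) 1, v = |g x|} →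
      ∀ n : ℕ, 1 ≤ n →
        modCont g (1 / n) + (1 / n) * supNorm g ≤
          (C / n) * ∑ k ∈ Finset.Icc 1 n, supNorm (fun t => Gop k g t - g t) := by

  obtain ⟨M, hM1, C, hC0, hcore⟩ := core
  set δ := 1 - sigmoid 4 with hδ
  have hδ0 : 0 < δ := by linarith [sig_lt_one 4]
  have hM' : (0 : ℝ) < M := by exact_mod_cast hM1
  refine ⟨M * (2 * C + (2 * C + 2) / δ) + 1 / δ, by positivity, ?_⟩
  intro g hbdd n hn
  have hn' : (0 : ℝ) < n := by exact_mod_cast hn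
  set B := supNorm g with hBdef
  have hB : ∀ x ∈ Icc (-1 : ℝ) 1, |g x| ≤ B := fun x hx => le_csSup hbdd ⟨x, hx, rfl⟩
  have hB0 : 0 ≤ B := supNorm_nonneg g
  set E : ℕ → ℝ := fun k => supNorm (fun t => Gop k g t - g t) with hE
  have hE0 : ∀ k, 0 ≤ E k := fun k => supNorm_nonneg _
  have hGS := fun k hk => Gop_sub_Sop k hk g B hB
  have hEk : ∀ k, 1 ≤ k → ∀ t ∈ Icc (-1 : ℝ) 1, |Gop k g t - g t| ≤ E k := by
    intro k hk
    apply le_supNorm (fun t => Gop k g t - g t) (2 * B * Real.exp (-k) + B + B)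
    intro t ht
    have h1 := hGS k hk t ht
    have h2 : |Sop k g t| ≤ B := by
      apply Lop_le
      intro j
      rw [beta_eq k hk]; exact hB _ (cl_mem _)
    have h3 := hB t ht
    rw [abs_le] at *
    constructor <;> linarith
  set S := ∑ k ∈ Finset.Icc 1 n, E k with hS
  have hBE : B * δ ≤ E 1 := by
    have : B ≤ E 1 + sigmoid 4 * B := by
      apply supNorm_le
      intro t ht
      have h1 := hEk 1 le_rfl t ht
      have h2 := Gop_one_bound g B hB t ht
      rw [abs_le] at *
      constructor <;> linarith
    rw [hδ]; linarith
  have hE1S : E 1 ≤ S :=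
    Finset.single_le_sum (f := E) (fun k _ => hE0 k) (by rw [Finset.mem_Icc]; omega)
  have hBS : B ≤ S / δ := by rw [le_div_iff₀ hδ0]; linarith
  set ω := modCont g (1 / n) with hω
  have hω2 : ω ≤ 2 * B := by
    apply modCont_le _ _ _ (by positivity)
    intro x hx y hy _
    have h1 := hB x hx
    have h2 := hB y hy
    rw [abs_le] at *
    constructor <;> linarith
  have hωk : ∀ k, 1 ≤ k → k ≤ n → ω ≤ C * (E k + E (M * k) + 2 * B * Real.exp (-k)) := by
    intro k hk hkn
    have hk' : (0 : ℝ) < k := by exact_mod_cast hk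
    have hkn' : (k : ℝ) ≤ n := by exact_mod_cast hkn
    have hMk : 1 ≤ M * k := Nat.mul_pos hM1 hk
    have hp := hE0 k
    have hp2 := hE0 (M * k)
    apply modCont_le _ _ _ (by positivity)
    intro x hx y hy hxy
    refine hcore g k hk _ ?_ ?_ x hx y hy (hxy.trans (one_div_le_one_div_of_le hk' hkn'))
    · intro t ht
      have h1 := hGS k hk t ht
      have h2 := hEk k hk t ht
      rw [abs_le] at *
      constructor <;> linarith
    · intro t ht
      have h1 := hGS (M * k) hMk t ht
      have h2 := hEk (M * k) hMk t ht
      have h3 : Real.exp (-((M * k : ℕ) : ℝ)) ≤ Real.exp (-k) := by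
        apply Real.exp_le_exp.2
        have : (k : ℝ) ≤ ((M * k : ℕ) : ℝ) := by exact_mod_cast Nat.le_mul_of_pos_left k hM1
        linarith
      have h4 := mul_le_mul_of_nonneg_left h3 (by positivity : 0 ≤ 2 * B)
      rw [abs_le] at *
      constructor <;> linarith
  set m := n / M with hm
  have hmn : m ≤ n := Nat.div_le_self n M
  have hsum : (m : ℝ) * ω ≤ C * (S + S + 2 * B) := by
    have h1 : ∑ k ∈ Finset.Icc 1 m, ω ≤
        ∑ k ∈ Finset.Icc 1 m, C * (E k + E (M * k) + 2 * B * Real.exp (-k)) := by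
      apply Finset.sum_le_sum
      intro k hk
      rw [Finset.mem_Icc] at hk
      exact hωk k hk.1 (hk.2.trans hmn)
    rw [Finset.sum_const, Nat.card_Icc, nsmul_eq_mul, Nat.add_sub_cancel, ← Finset.mul_sum,
      Finset.sum_add_distrib, Finset.sum_add_distrib, ← Finset.mul_sum] at h1
    have s1 : ∑ k ∈ Finset.Icc 1 m, E k ≤ S :=
      Finset.sum_le_sum_of_subset_of_nonneg (Finset.Icc_subset_Icc le_rfl hmn) (fun k _ _ => hE0 k)
    have s2 : ∑ k ∈ Finset.Icc 1 m, E (M * k) ≤ S := by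
      have hinj : Set.InjOn (fun k : ℕ => M * k) (Finset.Icc 1 m) := by
        intro a _ b _ h
        exact Nat.eq_of_mul_eq_mul_left hM1 h
      rw [← Finset.sum_image (s := Finset.Icc 1 m) (g := fun k : ℕ => M * k) (f := E) hinj]
      apply Finset.sum_le_sum_of_subset_of_nonneg _ (fun k _ _ => hE0 k)
      intro i hi
      rw [Finset.mem_image] at hi
      obtain ⟨k, hk, rfl⟩ := hi
      rw [Finset.mem_Icc] at hk ⊢
      refine ⟨Nat.mul_pos hM1 hk.1, ?_⟩
      exact (Nat.mul_le_mul_left M hk.2).trans (Nat.mul_div_le n M)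
    have s3 : ∑ k ∈ Finset.Icc 1 m, Real.exp (-(k : ℝ)) ≤ 1 := by
      linarith [exp_sum_le m, Real.exp_pos (-(m : ℝ))]
    have s4 := mul_le_mul_of_nonneg_left s3 (by positivity : 0 ≤ 2 * B)
    exact h1.trans (mul_le_mul_of_nonneg_left (by linarith) hC0.le)
  have hω0 : 0 ≤ ω := by
    apply Real.sSup_nonneg
    rintro v ⟨s, x, _, _, _, _, rfl⟩
    exact abs_nonneg _
  have hnm : (n : ℝ) ≤ M * (m + 1) := by
    exact_mod_cast (Nat.lt_mul_div_succ n hM1).le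
  have hnω : n * ω ≤ M * (C * (S + S + 2 * B) + 2 * B) := by
    calc (n : ℝ) * ω ≤ M * (m + 1) * ω := mul_le_mul_of_nonneg_right hnm hω0
      _ = M * (m * ω + ω) := by ring
      _ ≤ _ := mul_le_mul_of_nonneg_left (by linarith) hM'.le
  have hfin : n * ω + B ≤ (M * (2 * C + (2 * C + 2) / δ) + 1 / δ) * S := by
    have h1 : M * (C * (S + S + 2 * B) + 2 * B) ≤ M * (C * (S + S + 2 * (S / δ)) + 2 * (S / δ)) := by
      gcongr
    have h2 : (M * (2 * C + (2 * C + 2) / δ) + 1 / δ) * S =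
      M * (C * (S + S + 2 * (S / δ)) + 2 * (S / δ)) + S / δ := by ring
    linarith
  have e1 : ω + 1 / n * B = (n * ω + B) / n := by field_simp
  rw [e1, div_mul_eq_mul_div]
  gcongr
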